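/- Let n ≥ 1 and let f : ℝ^{n+1} → ℝ be bounded, of class C², and compactly supported, and let u(t,x) = ∫₀^∞ ∫_{ℝⁿ} W(τ,y) f(t−τ, x−y) dy dτ. Then for all i,j ∈ {1,…,n} and every (t,x) ∈ ℝ^{n+1} one has ∂_{x_i x_j} u(t,x) = lim_{ε→0} ∬_{Ω_ε} ∂_{y_i y_j} W(τ,y) f(t−τ, x−y) dy dτ − A_n δ_{ij} f(t,x). -/

import Mathlib

open MeasureTheory Filter Set Metric
open scoped ENNReal NNReal Topology

noncomputable section

abbrev En (n : ℕ) := EuclideanSpace ℝ (Fin n)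

/-- The Gauss–Weierstrass kernel `W(τ,y) = (4πτ)^{-n/2} exp(-|y|²/(4τ))`, extended by `0`
for `τ ≤ 0`. -/
def W (n : ℕ) (τ : ℝ) (y : En n) : ℝ :=
  if 0 < τ then (4 * Real.pi * τ) ^ (-(n : ℝ) / 2) * Real.exp (-‖y‖ ^ 2 / (4 * τ)) else 0

/-- Partial derivative of `g : ℝⁿ → ℝ` in the `i`-th coordinate direction. -/
def pd {n : ℕ} (i : Fin n) (g : En n → ℝ) (y : En n) : ℝ :=
  fderiv ℝ g y (EuclideanSpace.single i 1)

/-- Laplacian of `g : ℝⁿ → ℝ`. -/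
def lap {n : ℕ} (g : En n → ℝ) (x : En n) : ℝ :=
  ∑ i : Fin n, pd i (pd i g) x

/-- `∂_{y_i y_j} W(τ, ·)`. -/
def Wij (n : ℕ) (i j : Fin n) (τ : ℝ) (y : En n) : ℝ :=
  pd i (pd j (W n τ)) y

/-- `∂_τ W(·, y)`. -/
def Wt (n : ℕ) (τ : ℝ) (y : En n) : ℝ :=
  deriv (fun σ => W n σ y) τ

/-- The truncation region `Ω_ε = {(τ,y) : max(|τ|^{1/2}, |y|) > ε}`. -/
def Omega (n : ℕ) (ε : ℝ) : Set (ℝ × En n) :=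
  {p | ε < max (Real.sqrt |p.1|) ‖p.2‖}

/-- `A_n = (1/(n Γ(n/2))) ∫_{1/4}^∞ u^{n/2-1} e^{-u} du`. -/
def An (n : ℕ) : ℝ :=
  (1 / (n * Real.Gamma ((n : ℝ) / 2))) *
    ∫ u in Set.Ioi (1 / 4 : ℝ), u ^ ((n : ℝ) / 2 - 1) * Real.exp (-u)

/-- `B_n = (1/Γ(n/2)) ∫_0^{1/4} u^{n/2-1} e^{-u} du`. -/
def Bn (n : ℕ) : ℝ :=
  (1 / Real.Gamma ((n : ℝ) / 2)) *
    ∫ u in Set.Ioo (0 : ℝ) (1 / 4 : ℝ), u ^ ((n : ℝ) / 2 - 1) * Real.exp (-u)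

theorem W_of_nonpos {n : ℕ} {τ : ℝ} (h : τ ≤ 0) : W n τ = 0 := by
  funext y
  simp [W, not_lt.2 h]

theorem W_of_pos {n : ℕ} {τ : ℝ} (h : 0 < τ) (y : En n) :
    W n τ y = (4 * Real.pi * τ) ^ (-(n : ℝ) / 2) * Real.exp (-‖y‖ ^ 2 / (4 * τ)) := by
  simp [W, h]

theorem W_nonneg {n : ℕ} (τ : ℝ) (y : En n) : 0 ≤ W n τ y := by
  unfold W
  split_ifs with h <;> positivity

theorem measurable_W (n : ℕ) : Measurable (fun p : ℝ × En n => W n p.1 p.2) := by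
  unfold W
  refine Measurable.ite (measurableSet_lt measurable_const measurable_fst) ?_ measurable_const
  fun_prop

theorem hasFDerivAt_W {n : ℕ} (τ : ℝ) (y : En n) :
    HasFDerivAt (W n τ) ((-(W n τ y) / (2 * τ)) • innerSL ℝ y) y := by
  rcases le_or_gt τ 0 with h | h
  · rw [W_of_nonpos h]
    simpa using! hasFDerivAt_const (0 : ℝ) y
  · have h1 : HasFDerivAt (fun y : En n => (4 * Real.pi * τ) ^ (-(n : ℝ) / 2) *
        Real.exp ((-1 / (4 * τ)) * ‖y‖ ^ 2)) _ y :=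
      (((hasStrictFDerivAt_norm_sq y).hasFDerivAt.const_mul (-1 / (4 * τ))).exp).const_mul _
    have h2 : W n τ = fun y : En n => (4 * Real.pi * τ) ^ (-(n : ℝ) / 2) *
        Real.exp ((-1 / (4 * τ)) * ‖y‖ ^ 2) := by
      funext z
      rw [W_of_pos h]
      congr 2
      ring
    rw [h2]
    refine h1.congr_fderiv ?_
    ext v
    simp
    field_simp
    ring

theorem pd_W {n : ℕ} (j : Fin n) (τ : ℝ) :
    pd j (W n τ) = fun y => -(y j) / (2 * τ) * W n τ y := by
  funext y
  rw [pd, (hasFDerivAt_W τ y).fderiv]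
  simp [EuclideanSpace.inner_single_right]
  ring

theorem hasFDerivAt_pd_W {n : ℕ} (j : Fin n) (τ : ℝ) (y : En n) :
    HasFDerivAt (pd j (W n τ)) ((-(y j) / (2 * τ)) • ((-(W n τ y) / (2 * τ)) • innerSL ℝ y) +
      W n τ y • ((-1 / (2 * τ)) • (EuclideanSpace.proj j : En n →L[ℝ] ℝ))) y := by
  rw [pd_W]
  have h1 : HasFDerivAt (fun y : En n => -(y j) / (2 * τ))
      ((-1 / (2 * τ)) • (EuclideanSpace.proj j : En n →L[ℝ] ℝ)) y := by
    have := ((EuclideanSpace.proj j : En n →L[ℝ] ℝ).hasFDerivAt (x := y)).const_smul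
      (-1 / (2 * τ))
    refine this.congr_of_eventuallyEq (Eventually.of_forall fun z => ?_)
    simp
    ring
  exact h1.mul (hasFDerivAt_W τ y)

theorem Wij_eq {n : ℕ} (i j : Fin n) (τ : ℝ) (y : En n) :
    Wij n i j τ y = (y i * y j / (4 * τ ^ 2) - (if i = j then 1 else 0) / (2 * τ)) * W n τ y := by
  rw [Wij, pd, (hasFDerivAt_pd_W j τ y).fderiv]
  by_cases h : i = j
  · simp [h, EuclideanSpace.inner_single_right]
    ring
  · simp [h, Ne.symm h, EuclideanSpace.inner_single_right]
    ring

theorem measurable_Wij {n : ℕ} (i j : Fin n) :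
    Measurable (fun p : ℝ × En n => Wij n i j p.1 p.2) := by
  simp_rw [Wij_eq]
  have := measurable_W n
  fun_prop

theorem integral_W {n : ℕ} {τ : ℝ} (h : 0 < τ) : ∫ y : En n, W n τ y = 1 := by
  simp_rw [W_of_pos h, integral_const_mul]
  have h1 := GaussianFourier.integral_rexp_neg_mul_sq_norm (V := En n) (b := 1 / (4 * τ))
    (by positivity)
  have h2 : ∀ y : En n, -‖y‖ ^ 2 / (4 * τ) = -(1 / (4 * τ)) * ‖y‖ ^ 2 := fun y => by ring
  simp_rw [h2, h1]
  rw [finrank_euclideanSpace_fin, show Real.pi / (1 / (4 * τ)) = 4 * Real.pi * τ by field_simp,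
    ← Real.rpow_add (by positivity)]
  ring_nf
  simp

theorem integrable_W {n : ℕ} (τ : ℝ) : Integrable (W n τ) := by
  rcases le_or_gt τ 0 with h | h
  · rw [W_of_nonpos h]
    exact integrable_zero _ _ _
  · by_contra hc
    have := integral_W (n := n) h
    rw [integral_undef hc] at this
    exact zero_ne_one this

theorem sq_mul_W_le (n : ℕ) : ∃ C : ℝ, 0 ≤ C ∧ ∀ (τ : ℝ) (y : En n), 0 < τ →
    (τ + ‖y‖ ^ 2) ^ 2 * W n τ y ≤ C * τ ^ 2 * W n (4 * τ) y := by
  refine ⟨100 * (4 : ℝ) ^ ((n : ℝ) / 2), by positivity, fun τ y h => ?_⟩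
  rw [W_of_pos h, W_of_pos (by positivity : 0 < 4 * τ)]
  have h1 : (4 * Real.pi * (4 * τ)) ^ (-(n : ℝ) / 2) =
      (4 * Real.pi * τ) ^ (-(n : ℝ) / 2) * ((4 : ℝ) ^ ((n : ℝ) / 2))⁻¹ := by
    rw [show 4 * Real.pi * (4 * τ) = (4 * Real.pi * τ) * 4 by ring,
      Real.mul_rpow (by positivity) (by positivity), neg_div,
      Real.rpow_neg (by norm_num : (0 : ℝ) ≤ 4)]
  obtain ⟨s, hs, hs0⟩ : ∃ s, ‖y‖ ^ 2 = s * τ ∧ 0 ≤ s :=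
    ⟨‖y‖ ^ 2 / τ, by field_simp, by positivity⟩
  have h2 : Real.exp (-‖y‖ ^ 2 / (4 * (4 * τ))) =
      Real.exp (-‖y‖ ^ 2 / (4 * τ)) * Real.exp (3 * s / 16) := by
    rw [← Real.exp_add, hs]
    congr 1
    field_simp
    ring
  have h3 := Real.quadratic_le_exp_of_nonneg (by positivity : 0 ≤ 3 * s / 16)
  have h4 : (1 + s) ^ 2 ≤ 100 * Real.exp (3 * s / 16) := by nlinarith
  rw [h1, h2]
  set a := (4 * Real.pi * τ) ^ (-(n : ℝ) / 2) with ha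
  have ha0 : 0 ≤ a := by positivity
  set e := Real.exp (-‖y‖ ^ 2 / (4 * τ)) with he
  have hb : (4 : ℝ) ^ ((n : ℝ) / 2) ≠ 0 := by positivity
  calc (τ + ‖y‖ ^ 2) ^ 2 * (a * e) = (τ ^ 2 * (a * e)) * (1 + s) ^ 2 := by rw [hs]; ring
    _ ≤ (τ ^ 2 * (a * e)) * (100 * Real.exp (3 * s / 16)) := by gcongr
    _ = _ := by field_simp

theorem mul_W_le (n : ℕ) : ∃ C : ℝ, 0 ≤ C ∧ ∀ (τ : ℝ) (y : En n), 0 < τ →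
    (τ + ‖y‖ ^ 2) * W n τ y ≤ C * τ * W n (4 * τ) y := by
  obtain ⟨C, hC, h⟩ := sq_mul_W_le n
  refine ⟨C, hC, fun τ y hτ => le_of_mul_le_mul_left ?_ hτ⟩
  have h0 := W_nonneg τ y
  calc τ * ((τ + ‖y‖ ^ 2) * W n τ y) ≤ (τ + ‖y‖ ^ 2) * ((τ + ‖y‖ ^ 2) * W n τ y) := by
        gcongr
        nlinarith [sq_nonneg ‖y‖]
    _ = (τ + ‖y‖ ^ 2) ^ 2 * W n τ y := by ring
    _ ≤ _ := h τ y hτ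
    _ = _ := by ring

theorem abs_coord_le {n : ℕ} (y : En n) (i : Fin n) : |y i| ≤ ‖y‖ := by
  simpa using PiLp.norm_apply_le y i

theorem mul_abs_Wij_le (n : ℕ) : ∃ C : ℝ, 0 ≤ C ∧ ∀ (i j : Fin n) (τ : ℝ) (y : En n), 0 < τ →
    (τ + ‖y‖ ^ 2) * |Wij n i j τ y| ≤ C * W n (4 * τ) y := by
  obtain ⟨C, hC, h⟩ := sq_mul_W_le n
  refine ⟨C, hC, fun i j τ y hτ => ?_⟩
  have h0 := W_nonneg τ y
  have h1 : |y i * y j / (4 * τ ^ 2) - (if i = j then 1 else 0) / (2 * τ)| ≤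
      (τ + ‖y‖ ^ 2) / τ ^ 2 := by
    have ha : |y i * y j| ≤ ‖y‖ ^ 2 := by
      rw [abs_mul, sq]
      gcongr <;> exact abs_coord_le _ _
    have hb : |(if i = j then (1 : ℝ) else 0)| ≤ 1 := by split_ifs <;> simp
    calc _ ≤ |y i * y j / (4 * τ ^ 2)| + |(if i = j then (1 : ℝ) else 0) / (2 * τ)| := abs_sub _ _
      _ = |y i * y j| / (4 * τ ^ 2) + |(if i = j then (1 : ℝ) else 0)| / (2 * τ) := by
        rw [abs_div, abs_div, abs_of_pos (by positivity : 0 < 4 * τ ^ 2),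
          abs_of_pos (by positivity : 0 < 2 * τ)]
      _ ≤ ‖y‖ ^ 2 / (4 * τ ^ 2) + 1 / (2 * τ) := by gcongr
      _ ≤ ‖y‖ ^ 2 / τ ^ 2 + 1 / τ := by gcongr <;> nlinarith
      _ = _ := by field_simp; ring
  rw [Wij_eq, abs_mul, abs_of_nonneg h0]
  calc _ ≤ (τ + ‖y‖ ^ 2) * ((τ + ‖y‖ ^ 2) / τ ^ 2 * W n τ y) := by gcongr
    _ = ((τ + ‖y‖ ^ 2) ^ 2 * W n τ y) / τ ^ 2 := by ring
    _ ≤ (C * τ ^ 2 * W n (4 * τ) y) / τ ^ 2 :=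
        div_le_div_of_nonneg_right (h τ y hτ) (by positivity)
    _ = _ := by field_simp

theorem Wij_of_nonpos {n : ℕ} (i j : Fin n) {τ : ℝ} (h : τ ≤ 0) (y : En n) :
    Wij n i j τ y = 0 := by
  simp [Wij_eq, W_of_nonpos h]

theorem continuous_W {n : ℕ} (τ : ℝ) : Continuous (W n τ) :=
  continuous_iff_continuousAt.2 fun y => (hasFDerivAt_W τ y).continuousAt

theorem continuous_pd_W {n : ℕ} (j : Fin n) (τ : ℝ) : Continuous (pd j (W n τ)) :=
  continuous_iff_continuousAt.2 fun y => (hasFDerivAt_pd_W j τ y).continuousAt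

theorem continuous_Wij {n : ℕ} (i j : Fin n) (τ : ℝ) : Continuous (Wij n i j τ) := by
  have : Wij n i j τ = _ := funext fun y => Wij_eq i j τ y
  rw [this]
  have := continuous_W (n := n) τ
  fun_prop

theorem integrable_pd_W {n : ℕ} (j : Fin n) {τ : ℝ} (hτ : 0 < τ) :
    Integrable (pd j (W n τ)) := by
  obtain ⟨C, hC, h⟩ := mul_W_le n
  refine Integrable.mono' (((integrable_W (4 * τ)).const_mul (C * τ)).add
    ((integrable_W τ).const_mul 1) |>.const_mul (1 / (2 * τ)))
    (continuous_pd_W j τ).aestronglyMeasurable (Eventually.of_forall fun y => ?_)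
  have h0 := W_nonneg τ y
  have h1 := h τ y hτ
  rw [pd_W, Real.norm_eq_abs, abs_mul, abs_of_nonneg h0, abs_div, abs_neg,
    abs_of_pos (by positivity : 0 < 2 * τ)]
  have h2 : |y j| ≤ 1 + ‖y‖ ^ 2 := (abs_coord_le y j).trans (by nlinarith [sq_nonneg (‖y‖ - 1)])
  calc |y j| / (2 * τ) * W n τ y ≤ (1 + ‖y‖ ^ 2) / (2 * τ) * W n τ y := by gcongr
    _ ≤ (1 / (2 * τ)) * ((1 + ‖y‖ ^ 2) * W n τ y) := le_of_eq (by ring)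
    _ ≤ _ := by
      gcongr
      show _ ≤ C * τ * W n (4 * τ) y + 1 * W n τ y
      nlinarith

theorem integrable_Wij {n : ℕ} (i j : Fin n) (τ : ℝ) : Integrable (Wij n i j τ) := by
  rcases le_or_gt τ 0 with hτ | hτ
  · simp [funext (Wij_of_nonpos i j hτ)]
  obtain ⟨C, hC, h⟩ := mul_abs_Wij_le n
  refine Integrable.mono' ((integrable_W (4 * τ)).const_mul (C / τ))
    (continuous_Wij i j τ).aestronglyMeasurable (Eventually.of_forall fun y => ?_)
  rw [Real.norm_eq_abs, div_mul_eq_mul_div, le_div_iff₀ hτ]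
  refine le_trans ?_ (h i j τ y hτ)
  nlinarith [abs_nonneg (Wij n i j τ y), mul_nonneg (sq_nonneg ‖y‖) (abs_nonneg (Wij n i j τ y))]

theorem integral_Wij {n : ℕ} (i j : Fin n) (τ : ℝ) : ∫ y, Wij n i j τ y = 0 := by
  rcases le_or_gt τ 0 with hτ | hτ
  · simp [Wij_of_nonpos i j hτ]
  have := integral_mul_fderiv_eq_neg_fderiv_mul_of_integrable (μ := (volume : Measure (En n)))
    (f := fun _ => (1 : ℝ)) (g := pd j (W n τ)) (v := EuclideanSpace.single i 1)
    (by simp) (by simpa using! integrable_Wij i j τ) (by simpa using integrable_pd_W j hτ)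
    (by simp) (fun x _ => (hasFDerivAt_pd_W j τ x).differentiableAt)
  simpa using! this

/-- A time-weighted heat kernel is integrable in space-time. -/
theorem integrable_mul_W {n : ℕ} {φ : ℝ → ℝ} (hφ : Integrable φ) (hm : Measurable φ) {c : ℝ}
    (hc : 0 < c) : Integrable (fun p : ℝ × En n => φ p.1 * W n (c * p.1) p.2) := by
  have hmeas : Measurable (fun p : ℝ × En n => φ p.1 * W n (c * p.1) p.2) := by
    have := (measurable_W n).comp (g := fun p : ℝ × En n => W n p.1 p.2)
      (f := fun p : ℝ × En n => (c * p.1, p.2)) (by fun_prop)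
    exact (hm.comp measurable_fst).mul this
  rw [Measure.volume_eq_prod, integrable_prod_iff hmeas.aestronglyMeasurable]
  refine ⟨Eventually.of_forall fun τ => (integrable_W (c * τ)).const_mul (φ τ), ?_⟩
  refine Integrable.mono hφ (hmeas.norm.stronglyMeasurable.integral_prod_right').aestronglyMeasurable
    (Eventually.of_forall fun τ => ?_)
  simp_rw [norm_mul, integral_const_mul, Real.norm_of_nonneg (W_nonneg _ _)]
  rw [norm_mul, norm_norm]
  rcases le_or_gt τ 0 with h | h
  · simp [W_of_nonpos (mul_nonpos_of_nonneg_of_nonpos hc.le h)]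
  · rw [integral_W (by positivity)]
    simp

theorem measurableSet_Omega (n : ℕ) (ε : ℝ) : MeasurableSet (Omega n ε) := by
  unfold Omega
  exact measurableSet_lt measurable_const (by fun_prop)

theorem mem_Omega_iff {n : ℕ} {ε : ℝ} (hε : 0 < ε) {p : ℝ × En n} (hp : 0 < p.1) :
    p ∈ Omega n ε ↔ (p.1 ≤ ε ^ 2 → ε < ‖p.2‖) := by
  simp only [Omega, mem_ofPred_eq, lt_max_iff, abs_of_pos hp, Real.lt_sqrt hε.le]
  rw [← not_le, ← imp_iff_not_or]

theorem lt_add_sq_of_mem_Omega {n : ℕ} {ε : ℝ} (hε : 0 < ε) {p : ℝ × En n} (hp : 0 < p.1)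
    (h : p ∈ Omega n ε) : ε ^ 2 < p.1 + ‖p.2‖ ^ 2 := by
  rcases le_or_gt p.1 (ε ^ 2) with h1 | h1
  · have := (mem_Omega_iff hε hp).1 h h1
    nlinarith
  · nlinarith [sq_nonneg ‖p.2‖]

theorem integrableOn_Wij_Omega {n : ℕ} (i j : Fin n) {ε : ℝ} (hε : 0 < ε) (T : ℝ) :
    IntegrableOn (fun p : ℝ × En n => Wij n i j p.1 p.2) (Omega n ε ∩ {p | p.1 ≤ T}) := by
  obtain ⟨C, hC, h⟩ := mul_abs_Wij_le n
  have hms : MeasurableSet (Omega n ε ∩ {p | p.1 ≤ T}) :=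
    (measurableSet_Omega n ε).inter (measurableSet_le measurable_fst measurable_const)
  rw [← integrable_indicator_iff hms]
  have hφ : Integrable ((Ioc 0 T).indicator fun _ : ℝ => (1 : ℝ)) := by
    rw [integrable_indicator_iff measurableSet_Ioc]
    simp
  refine Integrable.mono' ((integrable_mul_W (n := n) hφ
    (measurable_const.indicator measurableSet_Ioc) (c := 4) (by norm_num)).const_mul (C / ε ^ 2))
    ((measurable_Wij i j).indicator hms).aestronglyMeasurable (Eventually.of_forall fun p => ?_)
  have hnn : 0 ≤ C / ε ^ 2 * ((Ioc 0 T).indicator (fun _ : ℝ => (1 : ℝ)) p.1 *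
      W n (4 * p.1) p.2) :=
    mul_nonneg (by positivity) (mul_nonneg (indicator_nonneg (by simp) _) (W_nonneg _ _))
  by_cases hp : p ∈ Omega n ε ∩ {p | p.1 ≤ T}
  · rcases le_or_gt p.1 0 with hp0 | hp0
    · rw [indicator_of_mem hp, Wij_of_nonpos i j hp0]
      simpa using hnn
    · rw [indicator_of_mem hp, indicator_of_mem (show p.1 ∈ Ioc 0 T from ⟨hp0, hp.2⟩),
        Real.norm_eq_abs, one_mul, div_mul_eq_mul_div, le_div_iff₀ (by positivity)]
      refine le_trans ?_ (h i j p.1 p.2 hp0)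
      rw [mul_comm]
      exact mul_le_mul_of_nonneg_right (lt_add_sq_of_mem_Omega hε hp0 hp.1).le (abs_nonneg _)
  · rw [indicator_of_notMem hp, norm_zero]
    exact hnn

theorem W_comp_isometry {n : ℕ} (R : En n ≃ₗᵢ[ℝ] En n) (τ : ℝ) (y : En n) :
    W n τ (R y) = W n τ y := by
  simp [W]

theorem setIntegral_comp_isometry {n : ℕ} (R : En n ≃ₗᵢ[ℝ] En n) (ε : ℝ) (g : En n → ℝ) :
    ∫ y in {y : En n | ε < ‖y‖}, g (R y) = ∫ y in {y : En n | ε < ‖y‖}, g y := by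
  have := R.measurePreserving.setIntegral_preimage_emb
    R.toHomeomorph.measurableEmbedding g {y : En n | ε < ‖y‖}
  simpa using this

theorem setIntegral_Wij_of_ne {n : ℕ} {i j : Fin n} (hij : i ≠ j) (ε τ : ℝ) :
    ∫ y in {y : En n | ε < ‖y‖}, Wij n i j τ y = 0 := by
  let R : En n ≃ₗᵢ[ℝ] En n := LinearIsometryEquiv.piLpCongrRight 2
    (fun k => if k = i then LinearIsometryEquiv.neg ℝ else LinearIsometryEquiv.refl ℝ ℝ)
  have h := setIntegral_comp_isometry R ε (Wij n i j τ)
  have h2 : ∀ y, Wij n i j τ (R y) = - Wij n i j τ y := by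
    intro y
    have hi : (R y) i = - y i := by simp [R]
    have hj : (R y) j = y j := by simp [R, hij.symm]
    rw [Wij_eq, Wij_eq, W_comp_isometry, hi, hj, if_neg hij]
    ring
  simp_rw [h2, integral_neg] at h
  linarith

theorem setIntegral_Wii_eq {n : ℕ} (i j : Fin n) (ε τ : ℝ) :
    ∫ y in {y : En n | ε < ‖y‖}, Wij n i i τ y = ∫ y in {y : En n | ε < ‖y‖}, Wij n j j τ y := by
  let R : En n ≃ₗᵢ[ℝ] En n := LinearIsometryEquiv.piLpCongrLeft 2 ℝ ℝ (Equiv.swap i j)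
  rw [← setIntegral_comp_isometry R ε (Wij n i i τ)]
  congr 1
  funext y
  have hi : (R y) i = y j := by simp [R, LinearIsometryEquiv.piLpCongrLeft_apply]
  rw [Wij_eq, Wij_eq, W_comp_isometry, hi]
  simp

theorem hasDerivAt_W_time {n : ℕ} {τ : ℝ} (h : 0 < τ) (y : En n) :
    HasDerivAt (fun σ => W n σ y) (∑ i, Wij n i i τ y) τ := by
  have h1 : HasDerivAt (fun σ : ℝ => (4 * Real.pi * σ) ^ (-(n : ℝ) / 2) *
      Real.exp (-‖y‖ ^ 2 / 4 * σ⁻¹)) _ τ :=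
    (((hasDerivAt_id τ).const_mul (4 * Real.pi)).rpow_const
      (Or.inl (by simp; positivity))).mul (((hasDerivAt_inv h.ne').const_mul (-‖y‖ ^ 2 / 4)).exp)
  have h2 : (fun σ => W n σ y) =ᶠ[𝓝 τ] (fun σ : ℝ => (4 * Real.pi * σ) ^ (-(n : ℝ) / 2) *
      Real.exp (-‖y‖ ^ 2 / 4 * σ⁻¹)) := by
    filter_upwards [lt_mem_nhds h] with σ hσ
    rw [W_of_pos hσ]
    congr 2
    field_simp
  refine (h1.congr_of_eventuallyEq h2).congr_deriv ?_
  have h3 : ∑ i, Wij n i i τ y = (‖y‖ ^ 2 / (4 * τ ^ 2) - n / (2 * τ)) * W n τ y := by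
    simp_rw [Wij_eq, ← Finset.sum_mul, Finset.sum_sub_distrib, EuclideanSpace.real_norm_sq_eq,
      Finset.sum_div]
    simp [sq]
    left
    ring
  rw [h3, W_of_pos h, id, Real.rpow_sub_one (by positivity),
    show -‖y‖ ^ 2 / (4 * τ) = -‖y‖ ^ 2 / 4 * τ⁻¹ by field_simp]
  field_simp
  ring

theorem continuous_W_time {n : ℕ} {y : En n} (hy : y ≠ 0) : Continuous (fun σ => W n σ y) := by
  rw [continuous_iff_continuousAt]
  intro τ
  rcases lt_trichotomy τ 0 with h | h | h
  · refine (continuousAt_const (y := (0 : ℝ))).congr ?_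
    filter_upwards [gt_mem_nhds h] with σ hσ
    rw [W_of_nonpos hσ.le]
    rfl
  · subst h
    rw [continuousAt_iff_continuous_left_right]
    have h0 : W n 0 y = 0 := by simp [W]
    constructor
    · refine (continuousWithinAt_const (b := (0 : ℝ))).congr (fun σ hσ => ?_) h0
      rw [W_of_nonpos hσ]
      rfl
    · rw [← continuousWithinAt_Ioi_iff_Ici, ContinuousWithinAt, h0]
      have h1 := (tendsto_rpow_mul_exp_neg_mul_atTop_nhds_zero ((n : ℝ) / 2) (‖y‖ ^ 2 / 4)
        (by positivity)).comp tendsto_inv_nhdsGT_zero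
      have h2 := h1.const_mul ((4 * Real.pi) ^ (-(n : ℝ) / 2))
      rw [mul_zero] at h2
      refine h2.congr' ?_
      filter_upwards [self_mem_nhdsWithin] with σ (hσ : 0 < σ)
      rw [W_of_pos hσ, Real.mul_rpow (by positivity) hσ.le, mul_assoc]
      congr 1
      simp only [Function.comp]
      congr 1
      · rw [neg_div, Real.rpow_neg hσ.le, Real.inv_rpow hσ.le]
      · congr 1
        field_simp
  · exact (hasDerivAt_W_time h y).continuousAt

theorem setIntegral_Ioc_sum_Wii {n : ℕ} {y : En n} (hy : y ≠ 0) {T : ℝ} (hT : 0 ≤ T)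
    (hint : IntegrableOn (fun τ => ∑ i, Wij n i i τ y) (Ioc 0 T)) :
    ∫ τ in Ioc 0 T, ∑ i, Wij n i i τ y = W n T y := by
  rw [← intervalIntegral.integral_of_le hT,
    intervalIntegral.integral_eq_sub_of_hasDerivAt_of_le hT (continuous_W_time hy).continuousOn
    (fun τ hτ => hasDerivAt_W_time hτ.1 y)
    ((intervalIntegrable_iff_integrableOn_Ioc_of_le hT).2 hint)]
  simp [W]

theorem integrableOn_Wij_prod {n : ℕ} (i j : Fin n) {ε : ℝ} (hε : 0 < ε) :
    IntegrableOn (fun p : ℝ × En n => Wij n i j p.1 p.2)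
      (Ioc 0 (ε ^ 2) ×ˢ {y : En n | ε < ‖y‖}) := by
  refine (integrableOn_Wij_Omega i j hε (ε ^ 2)).mono_set ?_
  rintro p ⟨hp1, hp2⟩
  exact ⟨(mem_Omega_iff hε hp1.1).2 fun _ => hp2, hp1.2⟩

theorem setIntegral_sum_Wii {n : ℕ} {ε : ℝ} (hε : 0 < ε) :
    ∫ p in Ioc 0 (ε ^ 2) ×ˢ {y : En n | ε < ‖y‖}, ∑ i, Wij n i i p.1 p.2 =
      ∫ y in {y : En n | ε < ‖y‖}, W n (ε ^ 2) y := by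
  have hint : IntegrableOn (fun p : ℝ × En n => ∑ i, Wij n i i p.1 p.2)
      (Ioc 0 (ε ^ 2) ×ˢ {y : En n | ε < ‖y‖}) :=
    integrable_finsetSum _ fun i _ => integrableOn_Wij_prod i i hε
  have hms : MeasurableSet {y : En n | ε < ‖y‖} :=
    measurableSet_lt measurable_const measurable_norm
  rw [IntegrableOn, Measure.volume_eq_prod, ← Measure.prod_restrict] at hint
  rw [Measure.volume_eq_prod, ← Measure.prod_restrict, integral_prod_symm _ hint]
  refine integral_congr_ae ?_
  filter_upwards [hint.prod_left_ae, ae_restrict_mem hms] with y hy (hy' : ε < ‖y‖)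
  exact setIntegral_Ioc_sum_Wii (norm_pos_iff.1 (hε.trans hy')) (by positivity) hy

theorem setIntegral_W_eq_An {n : ℕ} (hn : 1 ≤ n) {ε : ℝ} (hε : 0 < ε) :
    ∫ y in {y : En n | ε < ‖y‖}, W n (ε ^ 2) y = n * An n := by
  have hn0 : (0 : ℝ) < n := by exact_mod_cast hn
  have : Nonempty (Fin n) := ⟨⟨0, hn⟩⟩
  have : Nontrivial (En n) := by
    apply Module.nontrivial_of_finrank_pos (R := ℝ)
    rw [finrank_euclideanSpace_fin]
    exact hn
  have hms : MeasurableSet {y : En n | ε < ‖y‖} :=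
    measurableSet_lt measurable_const measurable_norm
  have hε2 : 0 < ε ^ 2 := by positivity
  set c : ℝ := (4 * Real.pi * ε ^ 2) ^ (-(n : ℝ) / 2) with hc
  let F : ℝ → ℝ := (Ioi ε).indicator fun r => c * Real.exp (-r ^ 2 / (4 * ε ^ 2))
  have h1 : ∫ y in {y : En n | ε < ‖y‖}, W n (ε ^ 2) y = ∫ y : En n, F ‖y‖ := by
    rw [← integral_indicator hms]
    congr 1
    funext y
    by_cases hy : ε < ‖y‖
    · rw [indicator_of_mem (show y ∈ {y : En n | ε < ‖y‖} from hy),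
        show F ‖y‖ = _ from indicator_of_mem (show ‖y‖ ∈ Ioi ε from hy) _, W_of_pos hε2]
    · rw [indicator_of_notMem (show y ∉ {y : En n | ε < ‖y‖} from hy),
        show F ‖y‖ = _ from indicator_of_notMem (show ‖y‖ ∉ Ioi ε from hy) _]
  have h2 : ∫ r in Ioi (0 : ℝ), r ^ (n - 1) • F r =
      c * ∫ r in Ioi ε, r ^ (n - 1) * Real.exp (-r ^ 2 / (4 * ε ^ 2)) := by
    have : ∀ r, r ^ (n - 1) • F r = (Ioi ε).indicator
        (fun r => c * (r ^ (n - 1) * Real.exp (-r ^ 2 / (4 * ε ^ 2)))) r := by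
      intro r
      by_cases hr : r ∈ Ioi ε
      · simp only [F, indicator_of_mem hr, smul_eq_mul]
        ring
      · simp only [F, indicator_of_notMem hr, smul_zero]
    simp_rw [this]
    rw [setIntegral_indicator measurableSet_Ioi, integral_const_mul,
      inter_eq_right.2 (Ioi_subset_Ioi hε.le)]
  have h3 : ∫ u in Ioi (1 / 4 : ℝ), u ^ ((n : ℝ) / 2 - 1) * Real.exp (-u) =
      2 * (4 * ε ^ 2) ^ (-(n : ℝ) / 2) *
        ∫ r in Ioi ε, r ^ (n - 1) * Real.exp (-r ^ 2 / (4 * ε ^ 2)) := by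
    have himg : (fun r : ℝ => r ^ 2 / (4 * ε ^ 2)) '' Ioi ε = Ioi (1 / 4) := by
      ext u
      constructor
      · rintro ⟨r, hr : ε < r, rfl⟩
        show 1 / 4 < r ^ 2 / (4 * ε ^ 2)
        rw [lt_div_iff₀ (by positivity)]
        nlinarith
      · intro (hu : 1 / 4 < u)
        have hu0 : 0 < u := by linarith
        refine ⟨Real.sqrt (u * (4 * ε ^ 2)), ?_, ?_⟩
        · exact Real.lt_sqrt_of_sq_lt (by nlinarith)
        · simp only
          rw [Real.sq_sqrt (by positivity)]
          field_simp
    rw [← himg, integral_image_eq_integral_abs_deriv_smul measurableSet_Ioi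
      (f' := fun r => r / (2 * ε ^ 2)), ← integral_const_mul]
    · refine setIntegral_congr_fun measurableSet_Ioi fun r (hr : ε < r) => ?_
      have hr0 : 0 < r := hε.trans hr
      have e1 : (r ^ 2) ^ ((n : ℝ) / 2 - 1) = r ^ (n - 1) / r := by
        rw [← Real.rpow_natCast r 2, ← Real.rpow_mul hr0.le, ← Real.rpow_natCast r (n - 1),
          ← Real.rpow_sub_one hr0.ne', Nat.cast_sub hn]
        congr 1
        push_cast
        ring
      have e2 : (4 * ε ^ 2) ^ ((n : ℝ) / 2 - 1) =
          ((4 * ε ^ 2) ^ (-(n : ℝ) / 2))⁻¹ / (4 * ε ^ 2) := by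
        rw [Real.rpow_sub_one (by positivity), neg_div, Real.rpow_neg (by positivity), inv_inv]
      have e3 : (4 * ε ^ 2) ^ (-(n : ℝ) / 2) ≠ 0 := by positivity
      simp only [smul_eq_mul]
      rw [abs_of_pos (by positivity), Real.div_rpow (by positivity) (by positivity), e1, e2,
        neg_div]
      field_simp
      ring
    · intro r _
      have := ((hasDerivAt_pow 2 r).div_const (4 * ε ^ 2)).hasDerivWithinAt (s := Ioi ε)
      refine this.congr_deriv ?_
      field_simp
      ring
    · intro a (ha : ε < a) b (hb : ε < b) hab
      have h4 : a ^ 2 = b ^ 2 := by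
        simp only at hab
        field_simp at hab
        exact hab
      exact (pow_left_inj₀ (by linarith) (by linarith) two_ne_zero).1 h4
  have hvol : (volume : Measure (En n)).real (ball 0 1) =
      Real.pi ^ ((n : ℝ) / 2) / ((n : ℝ) / 2 * Real.Gamma ((n : ℝ) / 2)) := by
    rw [Measure.real, EuclideanSpace.volume_ball, ← Real.Gamma_add_one (by positivity)]
    simp only [ENNReal.ofReal_one, one_pow, one_mul, Fintype.card_fin]
    rw [ENNReal.toReal_ofReal (div_nonneg (by positivity)
      (Real.Gamma_pos_of_pos (by positivity)).le), Real.sqrt_eq_rpow, ← Real.rpow_natCast,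
      ← Real.rpow_mul Real.pi_pos.le]
    ring_nf
  have hG : Real.Gamma ((n : ℝ) / 2) ≠ 0 := (Real.Gamma_pos_of_pos (by positivity)).ne'
  have hcc : c = Real.pi ^ (-(n : ℝ) / 2) * (4 * ε ^ 2) ^ (-(n : ℝ) / 2) := by
    rw [hc, ← Real.mul_rpow (by positivity) (by positivity)]
    ring_nf
  have hpi : Real.pi ^ ((n : ℝ) / 2) * Real.pi ^ (-(n : ℝ) / 2) = 1 := by
    rw [← Real.rpow_add Real.pi_pos]
    ring_nf
    simp
  rw [h1, integral_fun_norm_addHaar, finrank_euclideanSpace_fin, h2, hvol, An, h3, hcc]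
  simp only [nsmul_eq_mul, smul_eq_mul]
  set I := ∫ r in Ioi ε, r ^ (n - 1) * Real.exp (-r ^ 2 / (4 * ε ^ 2))
  calc _ = (Real.pi ^ ((n : ℝ) / 2) * Real.pi ^ (-(n : ℝ) / 2)) *
        (n / ((n : ℝ) / 2 * Real.Gamma ((n : ℝ) / 2)) * (4 * ε ^ 2) ^ (-(n : ℝ) / 2) * I) := by
        ring
    _ = _ := by
      rw [hpi]
      field_simp

theorem setIntegral_Wij_prod {n : ℕ} (hn : 1 ≤ n) (i j : Fin n) {ε : ℝ} (hε : 0 < ε) :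
    ∫ p in Ioc 0 (ε ^ 2) ×ˢ {y : En n | ε < ‖y‖}, Wij n i j p.1 p.2 =
      An n * (if i = j then 1 else 0) := by
  have hslice : ∀ k l : Fin n, ∫ p in Ioc 0 (ε ^ 2) ×ˢ {y : En n | ε < ‖y‖}, Wij n k l p.1 p.2 =
      ∫ τ in Ioc 0 (ε ^ 2), ∫ y in {y : En n | ε < ‖y‖}, Wij n k l τ y := fun k l => by
    have := integrableOn_Wij_prod k l hε
    rw [Measure.volume_eq_prod] at this ⊢
    exact setIntegral_prod _ this
  by_cases h : i = j
  · subst h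
    have hsum := (setIntegral_sum_Wii (n := n) hε).trans (setIntegral_W_eq_An hn hε)
    rw [integral_finsetSum _ fun k _ => integrableOn_Wij_prod k k hε] at hsum
    have heq : ∀ k : Fin n, ∫ p in Ioc 0 (ε ^ 2) ×ˢ {y : En n | ε < ‖y‖}, Wij n k k p.1 p.2 =
        ∫ p in Ioc 0 (ε ^ 2) ×ˢ {y : En n | ε < ‖y‖}, Wij n i i p.1 p.2 := fun k => by
      rw [hslice, hslice]
      simp_rw [setIntegral_Wii_eq k i]
    simp only [heq, Finset.sum_const, Finset.card_univ, Fintype.card_fin, nsmul_eq_mul] at hsum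
    have hn0 : (n : ℝ) ≠ 0 := by positivity
    rw [if_pos rfl, mul_one]
    exact mul_left_cancel₀ hn0 hsum
  · rw [hslice, if_neg h, mul_zero]
    simp_rw [setIntegral_Wij_of_ne h]
    simp

theorem locallyIntegrable_W (n : ℕ) :
    LocallyIntegrable (fun p : ℝ × En n => W n p.1 p.2) := by
  rw [locallyIntegrable_iff]
  intro K hK
  obtain ⟨T, hT⟩ := (hK.image continuous_fst).bddAbove
  have hφ : Integrable ((Ioc 0 T).indicator fun _ : ℝ => (1 : ℝ)) := by
    rw [integrable_indicator_iff measurableSet_Ioc]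
    simp
  rw [← integrable_indicator_iff hK.measurableSet]
  refine Integrable.mono' (integrable_mul_W (n := n) hφ
    (measurable_const.indicator measurableSet_Ioc) (c := 1) one_pos)
    ((measurable_W n).indicator hK.measurableSet).aestronglyMeasurable
    (Eventually.of_forall fun p => ?_)
  have hnn : 0 ≤ (Ioc 0 T).indicator (fun _ : ℝ => (1 : ℝ)) p.1 * W n (1 * p.1) p.2 :=
    mul_nonneg (indicator_nonneg (by simp) _) (W_nonneg _ _)
  by_cases hp : p ∈ K
  · rw [indicator_of_mem hp, Real.norm_of_nonneg (W_nonneg _ _)]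
    rcases le_or_gt p.1 0 with hp0 | hp0
    · rwa [W_of_nonpos hp0]
    · rw [indicator_of_mem (show p.1 ∈ Ioc 0 T from ⟨hp0, hT (mem_image_of_mem _ hp)⟩)]
      simp
  · rw [indicator_of_notMem hp, norm_zero]
    exact hnn

/-- Partial derivative of `g : ℝ × ℝⁿ → ℝ` in the `i`-th spatial coordinate direction. -/
def spatialPd {n : ℕ} (i : Fin n) (g : ℝ × En n → ℝ) (z : ℝ × En n) : ℝ :=
  fderiv ℝ g z (0, EuclideanSpace.single i 1)

theorem contDiff_spatialPd {n : ℕ} (i : Fin n) {g : ℝ × En n → ℝ} {k m : WithTop ℕ∞}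
    (hg : ContDiff ℝ k g) (hmk : m + 1 ≤ k) : ContDiff ℝ m (spatialPd i g) :=
  (hg.fderiv_right hmk).clm_apply contDiff_const

theorem hasCompactSupport_spatialPd {n : ℕ} (i : Fin n) {g : ℝ × En n → ℝ}
    (hg : HasCompactSupport g) : HasCompactSupport (spatialPd i g) :=
  hg.fderiv_apply ℝ _

theorem integrable_W_mul {n : ℕ} {g : ℝ × En n → ℝ} (hg : Continuous g)
    (hc : HasCompactSupport g) (t : ℝ) (x : En n) :
    Integrable (fun p : ℝ × En n => W n p.1 p.2 * g (t - p.1, x - p.2)) :=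
  hc.convolutionExists_right (ContinuousLinearMap.mul ℝ ℝ) (locallyIntegrable_W n) hg (t, x)

instance isAddHaarMeasure_volume_prod (n : ℕ) :
    (volume : Measure (ℝ × En n)).IsAddHaarMeasure :=
  Measure.prod.instIsAddHaarMeasure volume volume

/-- Spatial derivatives of the heat potential fall on the source term. -/
theorem pd_heat_potential {n : ℕ} (j : Fin n) {g : ℝ × En n → ℝ} (hg : ContDiff ℝ 1 g)
    (hc : HasCompactSupport g) (t : ℝ) (x : En n) :
    pd j (fun x' : En n => ∫ p : ℝ × En n, W n p.1 p.2 * g (t - p.1, x' - p.2)) x =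
      ∫ p : ℝ × En n, W n p.1 p.2 * spatialPd j g (t - p.1, x - p.2) := by
  have h1 := hc.hasFDerivAt_convolution_right (ContinuousLinearMap.mul ℝ ℝ)
    (locallyIntegrable_W n) hg (t, x)
  have h2 := h1.comp x ((hasFDerivAt_const t x).prodMk (hasFDerivAt_id x))
  have h3 := convolution_precompR_apply (ContinuousLinearMap.mul ℝ ℝ) (locallyIntegrable_W n)
    (hc.fderiv ℝ) (hg.continuous_fderiv one_ne_zero) (t, x) ((0 : ℝ), EuclideanSpace.single j 1)
  have h4 : HasFDerivAt
      (fun x' : En n => ∫ p : ℝ × En n, W n p.1 p.2 * g (t - p.1, x' - p.2)) _ x := h2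
  rw [pd, h4.fderiv]
  exact h3

theorem integral_pd_mul {n : ℕ} (i : Fin n) {V : En n → ℝ} (hV : Differentiable ℝ V)
    (hV' : Continuous (pd i V)) {g : ℝ × En n → ℝ} (hg : ContDiff ℝ 1 g)
    (hc : HasCompactSupport g) (s : ℝ) (x : En n) :
    ∫ y, pd i V y * g (s, x - y) = ∫ y, V y * spatialPd i g (s, x - y) := by
  have hslice : ∀ h : ℝ × En n → ℝ, HasCompactSupport h →
      HasCompactSupport fun y : En n => h (s, x - y) := fun h hh => by
    refine HasCompactSupport.intro (hh.image (f := fun p : ℝ × En n => x - p.2) (by fun_prop))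
      fun y hy => ?_
    by_contra hne
    exact hy ⟨(s, x - y), subset_tsupport _ hne, by simp⟩
  have hd : ∀ y, HasFDerivAt (fun y : En n => g (s, x - y)) ((fderiv ℝ g (s, x - y)).comp
      ((0 : En n →L[ℝ] ℝ).prod (-ContinuousLinearMap.id ℝ (En n)))) y := fun y =>
    (hg.differentiable one_ne_zero _).hasFDerivAt.comp y
      ((hasFDerivAt_const s y).prodMk ((hasFDerivAt_id y).const_sub x))
  have hpd : ∀ y, fderiv ℝ (fun y : En n => g (s, x - y)) y (EuclideanSpace.single i 1) =
      -spatialPd i g (s, x - y) := fun y => by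
    rw [(hd y).fderiv, spatialPd, ← map_neg]
    simp
  have hcs := hslice g hc
  have hcs' := hslice _ (hasCompactSupport_spatialPd i hc)
  have hgc : Continuous fun y : En n => g (s, x - y) := hg.continuous.comp (by fun_prop)
  have hgc' : Continuous fun y : En n => spatialPd i g (s, x - y) :=
    (contDiff_spatialPd i hg (m := 0) (by simp)).continuous.comp (by fun_prop)
  have h := integral_mul_fderiv_eq_neg_fderiv_mul_of_integrable (μ := (volume : Measure (En n)))
    (f := fun y : En n => g (s, x - y)) (g := V) (v := EuclideanSpace.single i 1)
    (by
      simp_rw [hpd]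
      exact (hgc'.neg.mul hV.continuous).integrable_of_hasCompactSupport hcs'.neg.mul_right)
    ((hgc.mul hV').integrable_of_hasCompactSupport hcs.mul_right)
    ((hgc.mul hV.continuous).integrable_of_hasCompactSupport hcs.mul_right)
    (fun y _ => (hd y).differentiableAt) (fun y _ => hV y)
  simp_rw [hpd, neg_mul, integral_neg, neg_neg] at h
  simp_rw [mul_comm (pd i V _), mul_comm (V _)]
  exact h

theorem Wij_symm {n : ℕ} (i j : Fin n) (τ : ℝ) (y : En n) : Wij n i j τ y = Wij n j i τ y := by
  rw [Wij_eq, Wij_eq, mul_comm (y i)]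
  simp only [eq_comm]

theorem integral_Wij_mul {n : ℕ} (i j : Fin n) {g : ℝ × En n → ℝ} (hg : ContDiff ℝ 2 g)
    (hc : HasCompactSupport g) (τ s : ℝ) (x : En n) :
    ∫ y, Wij n i j τ y * g (s, x - y) =
      ∫ y, W n τ y * spatialPd i (spatialPd j g) (s, x - y) := by
  simp_rw [Wij_symm i j]
  rw [← integral_pd_mul i (fun y => (hasFDerivAt_W τ y).differentiableAt) (continuous_pd_W i τ)
    (contDiff_spatialPd j hg (by norm_num)) (hasCompactSupport_spatialPd j hc),
    ← integral_pd_mul j (fun y => (hasFDerivAt_pd_W i τ y).differentiableAt)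
    (continuous_Wij j i τ) (hg.of_le (by norm_num)) hc]
  rfl

/-- Near the singularity, the kernel `Wij` is integrable against Lipschitz functions vanishing at
the singularity. -/
theorem integrable_indicator_Wij_mul {n : ℕ} (i j : Fin n) {h : ℝ × En n → ℝ}
    (hm : Measurable h) {L : ℝ} (hL : ∀ p, |h p| ≤ L * ‖p‖) :
    Integrable ((Omega n 1)ᶜ.indicator fun p : ℝ × En n => Wij n i j p.1 p.2 * h p) := by
  obtain ⟨C, hC, hW⟩ := mul_abs_Wij_le n
  have hφ : Integrable ((Ioc 0 1).indicator fun τ : ℝ => τ ^ (-(1 / 2) : ℝ)) := by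
    rw [integrable_indicator_iff measurableSet_Ioc,
      ← intervalIntegrable_iff_integrableOn_Ioc_of_le zero_le_one]
    exact intervalIntegral.intervalIntegrable_rpow' (by norm_num)
  have hφm : Measurable ((Ioc 0 1).indicator fun τ : ℝ => τ ^ (-(1 / 2) : ℝ)) :=
    Measurable.indicator (by fun_prop) measurableSet_Ioc
  have hL0 : 0 ≤ L := by
    have := (abs_nonneg _).trans (hL (1, 0))
    simpa [Prod.norm_def] using this
  refine Integrable.mono' ((integrable_mul_W (n := n) hφ hφm (c := 4) (by norm_num)).const_mul
    (2 * L * C)) (((measurable_Wij i j).mul hm).indicator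
      (measurableSet_Omega n 1).compl).aestronglyMeasurable (Eventually.of_forall fun p => ?_)
  have hnn : 0 ≤ 2 * L * C * ((Ioc 0 1).indicator (fun τ : ℝ => τ ^ (-(1 / 2) : ℝ)) p.1 *
      W n (4 * p.1) p.2) :=
    mul_nonneg (by positivity) (mul_nonneg
      (indicator_nonneg (fun τ hτ => Real.rpow_nonneg hτ.1.le _) _) (W_nonneg _ _))
  by_cases hp : p ∈ (Omega n 1)ᶜ
  · rw [indicator_of_mem hp]
    rcases le_or_gt p.1 0 with hp0 | hp0
    · rw [Wij_of_nonpos i j hp0, zero_mul, norm_zero]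
      exact hnn
    have hp1 : p.1 ≤ 1 := by
      by_contra hlt
      refine hp ((mem_Omega_iff one_pos hp0).2 fun h => ?_)
      simp only [one_pow] at h
      exact absurd h hlt
    rw [indicator_of_mem (show p.1 ∈ Ioc (0 : ℝ) 1 from ⟨hp0, hp1⟩), Real.norm_eq_abs, abs_mul]
    obtain ⟨r, hr0, hr⟩ : ∃ r, 0 < r ∧ r ^ 2 = p.1 :=
      ⟨Real.sqrt p.1, Real.sqrt_pos.2 hp0, Real.sq_sqrt hp0.le⟩
    have hr1 : r ≤ 1 := by nlinarith
    have hrpow : p.1 ^ (-(1 / 2) : ℝ) = r⁻¹ := by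
      rw [← hr, ← Real.rpow_natCast, ← Real.rpow_mul hr0.le, ← Real.rpow_neg_one]
      norm_num
    have hnorm : r * ‖p‖ ≤ 2 * (p.1 + ‖p.2‖ ^ 2) := by
      have : ‖p‖ ≤ p.1 + ‖p.2‖ := by
        rw [Prod.norm_def, Real.norm_of_nonneg hp0.le]
        exact max_le (by linarith [norm_nonneg p.2]) (by linarith)
      have h2 : r * ‖p‖ ≤ r * (r ^ 2 + ‖p.2‖) := by
        rw [hr]
        gcongr
      rw [← hr]
      nlinarith [sq_nonneg (r - ‖p.2‖), mul_le_mul_of_nonneg_right hr1 (sq_nonneg r)]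
    have key : |Wij n i j p.1 p.2| * (r * ‖p‖) ≤ 2 * (C * W n (4 * p.1) p.2) := by
      refine le_trans ?_ (mul_le_mul_of_nonneg_left (hW i j p.1 p.2 hp0) zero_le_two)
      calc _ ≤ |Wij n i j p.1 p.2| * (2 * (p.1 + ‖p.2‖ ^ 2)) := by gcongr
        _ = _ := by ring
    rw [hrpow]
    calc |Wij n i j p.1 p.2| * |h p| ≤ |Wij n i j p.1 p.2| * (L * ‖p‖) := by
          gcongr
          exact hL p
      _ = L * r⁻¹ * (|Wij n i j p.1 p.2| * (r * ‖p‖)) := by field_simp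
      _ ≤ L * r⁻¹ * (2 * (C * W n (4 * p.1) p.2)) := by gcongr
      _ = _ := by ring
  · rw [indicator_of_notMem hp, norm_zero]
    exact hnn

theorem tendsto_setIntegral_compl_Omega {n : ℕ} {H : ℝ × En n → ℝ}
    (hH : Integrable ((Omega n 1)ᶜ.indicator H)) (hm : Measurable H) (h0 : H 0 = 0) :
    Tendsto (fun ε : ℝ => ∫ p, (Omega n ε)ᶜ.indicator H p) (𝓝[>] 0) (𝓝 0) := by
  have hlim : Tendsto (fun ε : ℝ => ∫ p, (Omega n ε)ᶜ.indicator H p) (𝓝[>] 0)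
      (𝓝 (∫ _ : ℝ × En n, (0 : ℝ))) := by
    refine tendsto_integral_filter_of_dominated_convergence
      (fun p => ‖(Omega n 1)ᶜ.indicator H p‖)
      (Eventually.of_forall fun ε =>
        (hm.indicator (measurableSet_Omega n ε).compl).aestronglyMeasurable) ?_ hH.norm
      (Eventually.of_forall fun p => ?_)
    · filter_upwards [Ioc_mem_nhdsGT (zero_lt_one (α := ℝ))] with ε hε
      refine Eventually.of_forall fun p => ?_
      refine norm_indicator_le_of_subset (compl_subset_compl.2 fun q hq => ?_) H p
      exact hε.2.trans_lt hq
    · refine tendsto_const_nhds.congr' ?_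
      by_cases hp : p = 0
      · refine Eventually.of_forall fun ε => ?_
        by_cases hmem : (0 : ℝ × En n) ∈ (Omega n ε)ᶜ
        · simp only [hp, indicator_of_mem hmem, h0]
        · simp only [hp, indicator_of_notMem hmem]
      · have hpos : 0 < max (Real.sqrt |p.1|) ‖p.2‖ := by
          rw [lt_max_iff, Real.sqrt_pos, abs_pos, norm_pos_iff]
          by_contra! hc
          exact hp (Prod.ext hc.1 hc.2)
        filter_upwards [Ioo_mem_nhdsGT hpos] with ε hε
        have hmem : p ∈ Omega n ε := hε.2
        exact (indicator_of_notMem (notMem_compl_iff.2 hmem) H).symm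
  simpa using hlim

theorem integrable_indicator_Omega_Wij_mul {n : ℕ} (i j : Fin n) {f : ℝ × En n → ℝ}
    (hf : Continuous f) (hc : HasCompactSupport f) (t : ℝ) (x : En n) {ε : ℝ} (hε : 0 < ε) :
    Integrable ((Omega n ε).indicator
      fun p : ℝ × En n => Wij n i j p.1 p.2 * f (t - p.1, x - p.2)) := by
  obtain ⟨M, hM⟩ := hc.exists_bound_of_continuous hf
  obtain ⟨a, ha⟩ := (hc.image continuous_fst).bddBelow
  have hms : MeasurableSet (Omega n ε ∩ {p : ℝ × En n | p.1 ≤ t - a}) :=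
    (measurableSet_Omega n ε).inter (measurableSet_le measurable_fst measurable_const)
  have h1 := (integrable_indicator_iff hms).2 (integrableOn_Wij_Omega i j hε (t - a))
  have h2 : Continuous fun p : ℝ × En n => f (t - p.1, x - p.2) := hf.comp (by fun_prop)
  refine (h1.mul_bdd (c := M) h2.aestronglyMeasurable
    (Eventually.of_forall fun p => hM _)).congr (Eventually.of_forall fun p => ?_)
  by_cases hp : p ∈ Omega n ε
  · by_cases hT : p.1 ≤ t - a
    · simp only [indicator_of_mem hp, indicator_of_mem
        (show p ∈ Omega n ε ∩ {p : ℝ × En n | p.1 ≤ t - a} from ⟨hp, hT⟩)]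
    · have h0 : f (t - p.1, x - p.2) = 0 := by
        by_contra hne
        have := ha (mem_image_of_mem _ (subset_tsupport _ hne))
        simp only at this
        exact hT (by linarith)
      simp only [h0, mul_zero, indicator_of_mem hp]
  · simp only [indicator_of_notMem hp, zero_mul, indicator_of_notMem
      (show p ∉ Omega n ε ∩ {p : ℝ × En n | p.1 ≤ t - a} from fun h => hp h.1)]

/-- The truncated singular integral in terms of the second derivatives of the source. -/
theorem setIntegral_Omega_Wij_mul {n : ℕ} (hn : 1 ≤ n) (i j : Fin n) {f : ℝ × En n → ℝ}
    (hf : ContDiff ℝ 2 f) (hc : HasCompactSupport f) (t : ℝ) (x : En n) {ε : ℝ} (hε : 0 < ε)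
    (hH : Integrable ((Omega n ε)ᶜ.indicator fun p : ℝ × En n =>
      Wij n i j p.1 p.2 * (f (t - p.1, x - p.2) - f (t, x)))) :
    ∫ p in Omega n ε, Wij n i j p.1 p.2 * f (t - p.1, x - p.2) =
      (∫ p : ℝ × En n, W n p.1 p.2 * spatialPd i (spatialPd j f) (t - p.1, x - p.2)) +
        An n * (if i = j then 1 else 0) * f (t, x) -
        ∫ p, (Omega n ε)ᶜ.indicator (fun p : ℝ × En n =>
          Wij n i j p.1 p.2 * (f (t - p.1, x - p.2) - f (t, x))) p := by
  set S : Set (ℝ × En n) := Ioc 0 (ε ^ 2) ×ˢ {y : En n | ε < ‖y‖} with hS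
  have hSm : MeasurableSet S :=
    measurableSet_Ioc.prod (measurableSet_lt measurable_const measurable_norm)
  set D₁ := (Omega n ε).indicator
    fun p : ℝ × En n => Wij n i j p.1 p.2 * f (t - p.1, x - p.2) with hD₁
  set D₂ := S.indicator fun p : ℝ × En n => Wij n i j p.1 p.2 with hD₂
  set D₃ := (Omega n ε)ᶜ.indicator fun p : ℝ × En n =>
    Wij n i j p.1 p.2 * (f (t - p.1, x - p.2) - f (t, x)) with hD₃
  have hI₁ : Integrable D₁ := integrable_indicator_Omega_Wij_mul i j hf.continuous hc t x hε
  have hI₂ : Integrable D₂ := (integrable_indicator_iff hSm).2 (integrableOn_Wij_prod i j hε)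
  have hpt : ∀ (τ : ℝ) (y : En n), D₁ (τ, y) - f (t, x) * D₂ (τ, y) + D₃ (τ, y) =
      Wij n i j τ y * f (t - τ, x - y) -
        (f (t, x) * (Ioc 0 (ε ^ 2)).indicator 1 τ) * Wij n i j τ y := by
    classical
    intro τ y
    rcases le_or_gt τ 0 with hτ | hτ
    · simp only [hD₁, hD₂, hD₃, indicator_apply, Wij_of_nonpos i j hτ]
      simp
    · have hmem : (τ, y) ∈ Omega n ε ↔ (τ ≤ ε ^ 2 → ε < ‖y‖) :=
        mem_Omega_iff (p := (τ, y)) hε hτ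
      simp only [hD₁, hD₂, hD₃, hS, indicator_apply, mem_compl_iff, hmem, mem_prod, mem_Ioc, hτ,
        true_and, mem_ofPred_eq, Pi.one_apply]
      by_cases h1 : τ ≤ ε ^ 2 <;> by_cases h2 : ε < ‖y‖ <;> simp [h1, h2] <;> ring
  have hslice : ∀ τ : ℝ, ∫ y, (D₁ (τ, y) - f (t, x) * D₂ (τ, y) + D₃ (τ, y)) =
      ∫ y, W n τ y * spatialPd i (spatialPd j f) (t - τ, x - y) := by
    intro τ
    obtain ⟨M, hM⟩ := hc.exists_bound_of_continuous hf.continuous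
    have hfy : Continuous fun y : En n => f (t - τ, x - y) := hf.continuous.comp (by fun_prop)
    simp_rw [hpt]
    rw [integral_sub ((integrable_Wij i j τ).mul_bdd (c := M) hfy.aestronglyMeasurable
      (Eventually.of_forall fun y => hM _)) ((integrable_Wij i j τ).const_mul _),
      integral_const_mul, integral_Wij, mul_zero, sub_zero, integral_Wij_mul i j hf hc]
  have hcont : ContDiff ℝ 0 (spatialPd i (spatialPd j f)) :=
    contDiff_spatialPd i (contDiff_spatialPd j hf (m := 1) (by norm_num)) (by simp)
  have hIW := integrable_W_mul hcont.continuous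
    (hasCompactSupport_spatialPd i (hasCompactSupport_spatialPd j hc)) t x
  have hIall : Integrable fun p => D₁ p - f (t, x) * D₂ p + D₃ p :=
    (hI₁.sub (hI₂.const_mul _)).add hH
  have htotal : ∫ p, (D₁ p - f (t, x) * D₂ p + D₃ p) =
      ∫ p : ℝ × En n, W n p.1 p.2 * spatialPd i (spatialPd j f) (t - p.1, x - p.2) := by
    rw [Measure.volume_eq_prod] at hIall hIW ⊢
    rw [integral_prod _ hIall, integral_prod _ hIW]
    simp_rw [hslice]
  have hsplit : ∫ p, (D₁ p - f (t, x) * D₂ p + D₃ p) =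
      (∫ p, D₁ p) - f (t, x) * (∫ p, D₂ p) + ∫ p, D₃ p := by
    calc _ = (∫ p, (D₁ p - f (t, x) * D₂ p)) + ∫ p, D₃ p :=
          integral_add (hI₁.sub (hI₂.const_mul _)) hH
      _ = _ := by rw [integral_sub hI₁ (hI₂.const_mul _), integral_const_mul]
  rw [htotal, integral_indicator (measurableSet_Omega n ε), integral_indicator hSm,
    setIntegral_Wij_prod hn i j hε] at hsplit
  linarith

/-- for `f` bounded, `C²`, compactly supported, and
`u(t,x) = ∫₀^∞ ∫_{ℝⁿ} W(τ,y) f(t-τ,x-y) dy dτ`, the second spatial derivatives of `u` are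
given by principal values:
`∂_{x_i x_j} u(t,x) = lim_{ε→0} ∬_{Ω_ε} ∂_{y_i y_j}W(τ,y) f(t-τ,x-y) dy dτ − A_n δ_{ij} f(t,x)`,
i.e. the truncated integrals converge to `∂_{x_i x_j}u(t,x) + A_n δ_{ij} f(t,x)` as `ε → 0⁺`. -/
theorem heat_global_second_derivative_formula (n : ℕ) (hn : 1 ≤ n)
    (f : ℝ × En n → ℝ) (hfb : ∃ M, ∀ z, |f z| ≤ M) (hf2 : ContDiff ℝ 2 f)
    (hfc : HasCompactSupport f) (i j : Fin n) (t : ℝ) (x : En n) :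
    Tendsto
      (fun ε : ℝ => ∫ p in Omega n ε, Wij n i j p.1 p.2 * f (t - p.1, x - p.2))
      (𝓝[>] 0)
      (𝓝 (pd i (pd j (fun x' : En n =>
            ∫ p : ℝ × En n, W n p.1 p.2 * f (t - p.1, x' - p.2))) x
          + An n * (if i = j then 1 else 0) * f (t, x))) := by
  obtain ⟨L, hL⟩ := ContDiff.lipschitzWith_of_hasCompactSupport hfc hf2 two_ne_zero
  have hfm : Measurable fun p : ℝ × En n => f (t - p.1, x - p.2) - f (t, x) :=
    ((hf2.continuous.comp (by fun_prop : Continuous fun p : ℝ × En n =>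
      (t - p.1, x - p.2))).sub continuous_const).measurable
  have hbound : ∀ p : ℝ × En n, |f (t - p.1, x - p.2) - f (t, x)| ≤ (L : ℝ) * ‖p‖ := fun p => by
    have h := hL.norm_sub_le (t - p.1, x - p.2) (t, x)
    rwa [Prod.mk_sub_mk, sub_sub_cancel_left, sub_sub_cancel_left, ← Prod.neg_mk, norm_neg] at h
  have hH := integrable_indicator_Wij_mul i j hfm hbound
  have hHm : Measurable fun p : ℝ × En n =>
      Wij n i j p.1 p.2 * (f (t - p.1, x - p.2) - f (t, x)) := (measurable_Wij i j).mul hfm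
  have hlim := tendsto_setIntegral_compl_Omega hH hHm (by simp)
  have hpd : pd i (pd j (fun x' : En n =>
      ∫ p : ℝ × En n, W n p.1 p.2 * f (t - p.1, x' - p.2))) x =
      ∫ p : ℝ × En n, W n p.1 p.2 * spatialPd i (spatialPd j f) (t - p.1, x - p.2) := by
    rw [← pd_heat_potential i (contDiff_spatialPd j hf2 (by norm_num))
      (hasCompactSupport_spatialPd j hfc)]
    congr 1
    funext x'
    exact pd_heat_potential j (hf2.of_le (by norm_num)) hfc t x'
  rw [hpd]
  have hmain := hlim.const_sub
    ((∫ p : ℝ × En n, W n p.1 p.2 * spatialPd i (spatialPd j f) (t - p.1, x - p.2)) +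
      An n * (if i = j then 1 else 0) * f (t, x))
  rw [sub_zero] at hmain
  refine hmain.congr' ?_
  filter_upwards [Ioc_mem_nhdsGT (zero_lt_one (α := ℝ))] with ε hε
  refine (setIntegral_Omega_Wij_mul hn i j hf2 hfc t x hε.1 ?_).symm
  refine hH.mono (hHm.indicator (measurableSet_Omega n ε).compl).aestronglyMeasurable
    (Eventually.of_forall fun p => ?_)
  exact norm_indicator_le_of_subset
    (compl_subset_compl.2 fun q hq => hε.2.trans_lt hq) _ p
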